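/- arXiv:1011.3594 — 2 statements merged into one kernel-verified Lean document; each statement's English description precedes it below -/
import Mathlib

section
/- For every valid state w′, the time-reversed transition probabilities sum to one: Σ_{w valid} Q̃(w′, w) = 1. -/
open scoped BigOperators Classical

/-- A CSMA/CA state: on-off vector `x`, total transmission lengths `b`,
remaining times `a` (with the convention `b k = a k = 0` for inactive links). -/
structure CState (K : ℕ) where
  x : Fin K → Bool
  b : Fin K → ℕ
  a : Fin K → ℕ

variable {K : ℕ}

/-- The set of active links forming singleton components of the induced subgraph,
i.e. active links with no active neighbour. -/
noncomputable def Sset (G : SimpleGraph (Fin K)) (x : Fin K → Bool) : Finset (Fin K) :=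
  Finset.univ.filter (fun k => x k = true ∧ ∀ j, x j = true → ¬ G.Adj k j)

/-- The set of active links lying in components of size `> 1`,
i.e. active links with at least one active neighbour. -/
noncomputable def Zset (G : SimpleGraph (Fin K)) (x : Fin K → Bool) : Finset (Fin K) :=
  Finset.univ.filter (fun k => x k = true ∧ ∃ j, x j = true ∧ G.Adj k j)

/-- The number of connected components of the induced subgraph `G(x)` of size `> 1`. -/
noncomputable def hnum (G : SimpleGraph (Fin K)) (x : Fin K → Bool) : ℕ :=
  Nat.card {c : (G.induce {k | x k = true}).ConnectedComponent // 1 < Nat.card c.supp}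

/-- A valid CSMA/CA state. -/
def ValidState (G : SimpleGraph (Fin K)) (P : Fin K → ℕ → ℝ) (γ : ℕ) (w : CState K) : Prop :=
  (∀ k, w.x k = false → w.b k = 0 ∧ w.a k = 0) ∧
  (∀ k, w.x k = true → 1 ≤ w.a k ∧ w.a k ≤ w.b k) ∧
  (∀ k ∈ Sset G w.x, 0 < P k (w.b k)) ∧
  (∀ k ∈ Zset G w.x, w.b k = γ) ∧
  (∀ k ∈ Zset G w.x, ∀ j ∈ Zset G w.x, ∀ (hk : w.x k = true) (hj : w.x j = true),
     (G.induce {i | w.x i = true}).Reachable ⟨k, hk⟩ ⟨j, hj⟩ → w.a k = w.a j)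

/-- `f(b, j, x)`: equal to `1` for colliding links and `P j b` for successful links. -/
noncomputable def fwt (G : SimpleGraph (Fin K)) (P : Fin K → ℕ → ℝ) (b : ℕ) (j : Fin K)
    (x : Fin K → Bool) : ℝ :=
  if j ∈ Zset G x then 1 else P j b

/-- The unnormalized weight `π₀(w)`. -/
noncomputable def pi0 (G : SimpleGraph (Fin K)) (P : Fin K → ℕ → ℝ) (p : Fin K → ℝ)
    (w : CState K) : ℝ :=
  (∏ i ∈ Finset.univ.filter (fun i => w.x i = false), (1 - p i)) *
    ∏ j ∈ Finset.univ.filter (fun j => w.x j = true), (p j * fwt G P (w.b j) j w.x)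

/-- `A₁(w)`: active links whose remaining time exceeds `1`. -/
noncomputable def A1 (w : CState K) : Finset (Fin K) :=
  Finset.univ.filter (fun k => w.x k = true ∧ 1 < w.a k)

/-- `Ā₁(w) = A₁(w) ∪ ∂A₁(w)`. -/
noncomputable def A1bar (G : SimpleGraph (Fin K)) (w : CState K) : Finset (Fin K) :=
  A1 w ∪ Finset.univ.filter (fun j => w.x j = false ∧ ∃ k ∈ A1 w, G.Adj j k)

/-- `A₂(w)`: the complement of `Ā₁(w)`. -/
noncomputable def A2 (G : SimpleGraph (Fin K)) (w : CState K) : Finset (Fin K) :=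
  Finset.univ \ A1bar G w

/-- Admissibility of the ordered pair of states `(w, w')`. -/
def Admissible (G : SimpleGraph (Fin K)) (γ : ℕ) (w w' : CState K) : Prop :=
  (∀ k ∈ A1bar G w, w'.x k = w.x k) ∧
  (∀ k ∈ A1bar G w, w.x k = true → w'.b k = w.b k ∧ w'.a k = w.a k - 1) ∧
  (∀ k ∈ A2 G w, w'.x k = true → w'.a k = w'.b k) ∧
  (∀ k ∈ A2 G w, k ∈ Zset G w'.x → w'.b k = γ)

/-- The transition probability `Q(w, w')` of the CSMA/CA Markov chain. -/
noncomputable def Qmat (G : SimpleGraph (Fin K)) (P : Fin K → ℕ → ℝ) (p : Fin K → ℝ) (γ : ℕ)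
    (w w' : CState K) : ℝ :=
  if Admissible G γ w w' then
    ∏ i ∈ A2 G w, (if w'.x i then p i * fwt G P (w'.b i) i w'.x else 1 - p i)
  else 0

/-- The time-reversed transition probability `Q̃(w', w)`. -/
noncomputable def Qtil (G : SimpleGraph (Fin K)) (P : Fin K → ℕ → ℝ) (p : Fin K → ℝ) (γ : ℕ)
    (w' w : CState K) : ℝ :=
  if Admissible G γ w w' then
    ∏ i ∈ A2 G w, (if w.x i then p i * fwt G P (w.b i) i w.x else 1 - p i)
  else 0

/-- The reversal map `g`. -/
def revState (w : CState K) : CState K :=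
  ⟨w.x, w.b, fun k => if w.x k then w.b k - w.a k + 1 else 0⟩


theorem valid_adj {G : SimpleGraph (Fin K)} {P : Fin K → ℕ → ℝ} {γ : ℕ} {w : CState K}
    (hw : ValidState G P γ w) {u v : Fin K} (hu : w.x u = true) (hv : w.x v = true)
    (h : G.Adj u v) : w.a u = w.a v ∧ w.b u = γ ∧ w.b v = γ := by
  obtain ⟨_, _, _, h4, h5⟩ := hw
  have zu : u ∈ Zset G w.x := by simp only [Zset, Finset.mem_filter, Finset.mem_univ, true_and]; exact ⟨hu, v, hv, h⟩
  have zv : v ∈ Zset G w.x := by simp only [Zset, Finset.mem_filter, Finset.mem_univ, true_and]; exact ⟨hv, u, hu, h.symm⟩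
  refine ⟨h5 u zu v zv hu hv ?_, h4 u zu, h4 v zv⟩
  apply SimpleGraph.Adj.reachable
  simpa using h

theorem reach_const {V α : Type*} {H : SimpleGraph V} {f : V → α}
    (h : ∀ u v, H.Adj u v → f u = f v) {u v : V} (r : H.Reachable u v) : f u = f v := by
  obtain ⟨p⟩ := r
  induction p with
  | nil => rfl
  | cons hadj _ ih => rw [h _ _ hadj, ih]

theorem mem_A1 {w : CState K} {k : Fin K} : k ∈ A1 w ↔ w.x k = true ∧ 1 < w.a k := by
  simp [A1]

theorem mem_A1bar {G : SimpleGraph (Fin K)} {w : CState K} {k : Fin K} :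
    k ∈ A1bar G w ↔ k ∈ A1 w ∨ (w.x k = false ∧ ∃ j ∈ A1 w, G.Adj k j) := by
  simp [A1bar]

theorem mem_A2 {G : SimpleGraph (Fin K)} {w : CState K} {k : Fin K} :
    k ∈ A2 G w ↔ k ∉ A1bar G w := by
  simp [A2]

/-- links that are in the middle of a transmission, read off from the later state -/
noncomputable def B1 (w' : CState K) : Finset (Fin K) :=
  Finset.univ.filter (fun k => w'.x k = true ∧ w'.a k < w'.b k)

noncomputable def Bbar (G : SimpleGraph (Fin K)) (w' : CState K) : Finset (Fin K) :=
  Finset.univ.filter (fun k => k ∈ B1 w' ∨ ∃ j ∈ B1 w', G.Adj k j)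

theorem mem_B1 {w : CState K} {k : Fin K} : k ∈ B1 w ↔ w.x k = true ∧ w.a k < w.b k := by
  simp [B1]

theorem mem_Bbar {G : SimpleGraph (Fin K)} {w : CState K} {k : Fin K} :
    k ∈ Bbar G w ↔ k ∈ B1 w ∨ ∃ j ∈ B1 w, G.Adj k j := by
  simp [Bbar]

theorem Bbar_active {G : SimpleGraph (Fin K)} {P : Fin K → ℕ → ℝ} {γ : ℕ} {w' : CState K}
    (hw' : ValidState G P γ w') {k : Fin K} (hk : k ∈ Bbar G w') (hx : w'.x k = true) :
    k ∈ B1 w' := by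
  rcases mem_Bbar.1 hk with h | ⟨j, hj, hadj⟩
  · exact h
  · have h1 := mem_B1.1 hj
    have h2 := valid_adj hw' hx h1.1 hadj
    exact mem_B1.2 ⟨hx, by omega⟩

theorem adm_A1 {G : SimpleGraph (Fin K)} {P : Fin K → ℕ → ℝ} {γ : ℕ} {w w' : CState K}
    (hw : ValidState G P γ w)
    (h : Admissible G γ w w') : A1 w = B1 w' := by
  obtain ⟨h1, h2, h3, h4⟩ := h
  ext k
  rw [mem_B1]
  constructor
  · intro hk
    have hb : k ∈ A1bar G w := mem_A1bar.2 (Or.inl hk)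
    have hk' := mem_A1.1 hk
    have e1 := h1 k hb
    have e2 := h2 k hb hk'.1
    have e3 := hw.2.1 k hk'.1
    refine ⟨by rw [e1, hk'.1], by omega⟩
  · rintro ⟨hx, hlt⟩
    have hb : k ∈ A1bar G w := by
      by_contra hc
      have := h3 k (mem_A2.2 hc) hx
      omega
    rcases mem_A1bar.1 hb with h | h
    · exact h
    · have := h1 k hb
      rw [hx, h.1] at this
      cases this

theorem A1bar_eq {G : SimpleGraph (Fin K)} {P : Fin K → ℕ → ℝ} {γ : ℕ} {w w' : CState K}
    (hw : ValidState G P γ w)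
    (h : A1 w = B1 w') : A1bar G w = Bbar G w' := by
  ext k
  rw [mem_A1bar, mem_Bbar, ← h]
  constructor
  · rintro (h | ⟨_, h⟩)
    · exact Or.inl h
    · exact Or.inr h
  · rintro (h | ⟨j, hj, hadj⟩)
    · exact Or.inl h
    · cases hx : w.x k
      · exact Or.inr ⟨rfl, j, hj, hadj⟩
      · left
        have hj' := mem_A1.1 hj
        have := valid_adj hw hx hj'.1 hadj
        exact mem_A1.2 ⟨hx, by omega⟩

noncomputable def mkS (G : SimpleGraph (Fin K)) (w' : CState K)
    (s : (_ : Fin K → Bool) × (Fin K → ℕ)) : CState K :=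
  ⟨s.1, s.2, fun i => if i ∈ Bbar G w' then (if w'.x i then w'.a i + 1 else 0)
    else (if s.1 i then 1 else 0)⟩

noncomputable def Xset (G : SimpleGraph (Fin K)) (w' : CState K) : Finset (Fin K → Bool) :=
  Fintype.piFinset (fun i => if i ∈ Bbar G w' then {w'.x i} else Finset.univ)

noncomputable def tset (G : SimpleGraph (Fin K)) (P : Fin K → ℕ → ℝ) (γ bmax : ℕ) (w' : CState K)
    (x : Fin K → Bool) (i : Fin K) : Finset ℕ :=
  if i ∈ Bbar G w' then {w'.b i} else
    if x i = true then
      (if i ∈ Zset G x then {γ} else (Finset.range (bmax + 1)).filter (fun b => 0 < P i b))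
    else {0}

noncomputable def Sall (G : SimpleGraph (Fin K)) (P : Fin K → ℕ → ℝ) (γ bmax : ℕ)
    (w' : CState K) : Finset ((_ : Fin K → Bool) × (Fin K → ℕ)) :=
  (Xset G w').sigma (fun x => Fintype.piFinset (tset G P γ bmax w' x))

theorem mem_Sall {G : SimpleGraph (Fin K)} {P : Fin K → ℕ → ℝ} {γ bmax : ℕ}
    {w' : CState K} {s : (_ : Fin K → Bool) × (Fin K → ℕ)} :
    s ∈ Sall G P γ bmax w' ↔
      (∀ i ∈ Bbar G w', s.1 i = w'.x i) ∧ (∀ i, s.2 i ∈ tset G P γ bmax w' s.1 i) := by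
  simp only [Sall, Finset.mem_sigma, Xset, Fintype.mem_piFinset]
  refine and_congr (forall_congr' fun i => ?_) Iff.rfl
  by_cases h : i ∈ Bbar G w' <;> simp [h]

theorem mem_Sset {G : SimpleGraph (Fin K)} {x : Fin K → Bool} {k : Fin K} :
    k ∈ Sset G x ↔ x k = true ∧ ∀ j, x j = true → ¬ G.Adj k j := by simp [Sset]

theorem mem_Zset {G : SimpleGraph (Fin K)} {x : Fin K → Bool} {k : Fin K} :
    k ∈ Zset G x ↔ x k = true ∧ ∃ j, x j = true ∧ G.Adj k j := by simp [Zset]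

theorem mem_Sset_of {G : SimpleGraph (Fin K)} {x : Fin K → Bool} {k : Fin K}
    (hx : x k = true) (hz : k ∉ Zset G x) : k ∈ Sset G x := by
  rw [mem_Zset] at hz; rw [mem_Sset]; grind

theorem mk_valid {G : SimpleGraph (Fin K)} {P : Fin K → ℕ → ℝ} {γ bmax : ℕ}
    (hγ : 1 ≤ γ) (hP0 : ∀ k, P k 0 = 0)
    {w' : CState K} (hw' : ValidState G P γ w') {s : (_ : Fin K → Bool) × (Fin K → ℕ)}
    (hs : s ∈ Sall G P γ bmax w') :
    ValidState G P γ (mkS G w' s) ∧ A1 (mkS G w' s) = B1 w' := by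
  obtain ⟨hx, ht⟩ := mem_Sall.1 hs
  obtain ⟨v1, v2, v3, v4, v5⟩ := hw'
  have hw' : ValidState G P γ w' := ⟨v1, v2, v3, v4, v5⟩
  have hzz : ∀ k ∈ Bbar G w', k ∈ Zset G s.1 → k ∈ Zset G w'.x := by
    intro k hk hz
    obtain ⟨h1, j, hj, hadj⟩ := mem_Zset.1 hz
    have hkx : w'.x k = true := by rw [← hx k hk, h1]
    have hkB := Bbar_active hw' hk hkx
    have hjB : j ∈ Bbar G w' := mem_Bbar.2 (Or.inr ⟨k, hkB, hadj.symm⟩)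
    exact mem_Zset.2 ⟨hkx, j, by rw [← hx j hjB, hj], hadj⟩
  have hss : ∀ k ∈ Bbar G w', k ∈ Sset G s.1 → k ∈ Sset G w'.x := by
    intro k hk hz
    obtain ⟨h1, h2⟩ := mem_Sset.1 hz
    have hkx : w'.x k = true := by rw [← hx k hk, h1]
    have hkB := Bbar_active hw' hk hkx
    refine mem_Sset.2 ⟨hkx, fun j hj hadj => ?_⟩
    have hjB : j ∈ Bbar G w' := mem_Bbar.2 (Or.inr ⟨k, hkB, hadj.symm⟩)
    exact h2 j (by rw [hx j hjB, hj]) hadj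
  refine ⟨⟨?_, ?_, ?_, ?_, ?_⟩, ?_⟩
  · intro k hk
    have := ht k
    simp only [mkS] at hk ⊢
    by_cases hB : k ∈ Bbar G w'
    · have e := hx k hB
      have := v1 k (by rw [← e, hk])
      simp_all [tset]
    · simp_all [tset]
  · intro k hk
    have := ht k
    simp only [mkS] at hk ⊢
    by_cases hB : k ∈ Bbar G w'
    · have e := hx k hB
      have e' : w'.x k = true := by rw [← e, hk]
      have := v2 k e'
      have := mem_B1.1 (Bbar_active hw' hB e')
      simp_all [tset]
    · simp only [tset, hB, hk, if_true, if_false] at this ⊢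
      refine ⟨le_rfl, ?_⟩
      split_ifs at this with hZ
      · simp only [Finset.mem_singleton] at this; omega
      · have h3 := (Finset.mem_filter.1 this).2
        by_contra hc
        have : s.2 k = 0 := by omega
        rw [this, hP0] at h3
        exact lt_irrefl _ h3
  · intro k hk
    have := ht k
    simp only [mkS] at hk ⊢
    by_cases hB : k ∈ Bbar G w'
    · have := v3 k (hss k hB hk)
      simp_all [tset]
    · have hz : k ∉ Zset G s.1 := by
        rw [mem_Zset]; rw [mem_Sset] at hk; grind
      have := (mem_Sset.1 hk).1
      simp_all [tset]
  · intro k hk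
    have := ht k
    simp only [mkS] at hk ⊢
    by_cases hB : k ∈ Bbar G w'
    · have := v4 k (hzz k hB hk)
      simp_all [tset]
    · have := (mem_Zset.1 hk).1
      simp_all [tset]
  · intro k _ j _ hk hj r
    refine reach_const (f := fun u => (mkS G w' s).a u.1) ?_ r
    rintro ⟨u, hu⟩ ⟨v, hv⟩ hadj
    have hadj : G.Adj u v := by simpa using hadj
    simp only [mkS, Set.mem_ofPred_eq] at hu hv ⊢
    have key : ∀ u v, s.1 u = true → s.1 v = true → G.Adj u v → u ∈ Bbar G w' →
        v ∈ Bbar G w' ∧ w'.x u = true ∧ w'.x v = true ∧ w'.a u = w'.a v := by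
      intro u v hu hv hadj hB
      have hux : w'.x u = true := by rw [← hx u hB, hu]
      have hvB : v ∈ Bbar G w' :=
        mem_Bbar.2 (Or.inr ⟨u, Bbar_active hw' hB hux, hadj.symm⟩)
      have hvx : w'.x v = true := by rw [← hx v hvB, hv]
      exact ⟨hvB, hux, hvx, (valid_adj hw' hux hvx hadj).1⟩
    have k1 := key u v hu hv hadj
    have k2 := key v u hv hu hadj.symm
    grind
  · ext k
    rw [mem_A1]
    simp only [mkS]
    by_cases hB : k ∈ Bbar G w'
    · have e := hx k hB
      constructor
      · rintro ⟨h1, _⟩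
        exact Bbar_active hw' hB (by rw [← e, h1])
      · intro h
        have h' := mem_B1.1 h
        have := v2 k h'.1
        simp only [hB, h'.1, e, if_true, true_and]
        omega
    · have : k ∉ B1 w' := fun h => hB (mem_Bbar.2 (Or.inl h))
      simp only [hB, this, if_false, iff_false]
      grind

theorem mk_adm {G : SimpleGraph (Fin K)} {P : Fin K → ℕ → ℝ} {γ bmax : ℕ}
    (hγ : 1 ≤ γ) (hP0 : ∀ k, P k 0 = 0)
    {w' : CState K} (hw' : ValidState G P γ w') {s : (_ : Fin K → Bool) × (Fin K → ℕ)}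
    (hs : s ∈ Sall G P γ bmax w') :
    Admissible G γ (mkS G w' s) w' := by
  obtain ⟨hv, hA⟩ := mk_valid hγ hP0 hw' hs
  have hB := A1bar_eq hv hA
  obtain ⟨hx, ht⟩ := mem_Sall.1 hs
  refine ⟨?_, ?_, ?_, ?_⟩
  · intro k hk
    rw [hB] at hk
    exact (hx k hk).symm
  · intro k hk h1
    rw [hB] at hk
    have := ht k
    have e := hx k hk
    simp only [mkS] at h1 ⊢
    have e' : w'.x k = true := by rw [← e, h1]
    simp_all [tset]
  · intro k hk h1
    rw [mem_A2, hB, mem_Bbar] at hk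
    have := hw'.2.1 k h1
    have h3 : k ∉ B1 w' := fun h => hk (Or.inl h)
    rw [mem_B1] at h3
    by_contra hc
    exact h3 ⟨h1, by omega⟩
  · intro k _ hz
    exact hw'.2.2.2.1 k hz

theorem adm_mk {G : SimpleGraph (Fin K)} {P : Fin K → ℕ → ℝ} {γ bmax : ℕ}
    (hb : ∀ k b, bmax < b → P k b = 0)
    {w w' : CState K} (hw' : ValidState G P γ w') (hw : ValidState G P γ w)
    (h : Admissible G γ w w') :
    ∃ s ∈ Sall G P γ bmax w', mkS G w' s = w := by
  have hA := adm_A1 hw h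
  have hB := A1bar_eq hw hA
  obtain ⟨h1, h2, h3, h4⟩ := h
  rw [hB] at h1 h2
  obtain ⟨v1, v2, v3, v4, v5⟩ := hw
  refine ⟨⟨w.x, w.b⟩, mem_Sall.2 ⟨fun i hi => (h1 i hi).symm, fun i => ?_⟩, ?_⟩
  · simp only [tset]
    split_ifs with g1 g2 g3
    · rw [Finset.mem_singleton]
      cases hx : w.x i
      · rw [(v1 i hx).1, (hw'.1 i (by rw [h1 i g1, hx])).1]
      · exact (h2 i g1 hx).1.symm
    · rw [Finset.mem_singleton]; exact v4 i g3
    · have := v3 i (mem_Sset_of g2 g3)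
      rw [Finset.mem_filter, Finset.mem_range]
      refine ⟨?_, this⟩
      by_contra hc
      rw [hb i _ (by omega)] at this
      exact lt_irrefl _ this
    · rw [Finset.mem_singleton]
      exact (v1 i (by simpa using g2)).1
  · have : (mkS G w' ⟨w.x, w.b⟩).a = w.a := by
      funext i
      simp only [mkS]
      split_ifs with g1 g2 g3
      · have hx : w.x i = true := by rw [← h1 i g1, g2]
        have := h2 i g1 hx
        have := v2 i hx
        omega
      · exact (v1 i (by rw [← h1 i g1]; simpa using g2)).2.symm
      · have n : i ∉ A1 w := fun h => g1 (by rw [← hB]; exact mem_A1bar.2 (Or.inl h))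
        rw [mem_A1] at n
        have := v2 i g3
        have : ¬ 1 < w.a i := fun h => n ⟨g3, h⟩
        omega
      · exact (v1 i (by simpa using g3)).2.symm
    cases w
    simp only [mkS, CState.mk.injEq, true_and] at this ⊢
    exact this

theorem mkS_inj (G : SimpleGraph (Fin K)) (w' : CState K) : Function.Injective (mkS G w') := by
  rintro ⟨x, b⟩ ⟨y, c⟩ h
  simp only [mkS, CState.mk.injEq] at h
  obtain ⟨rfl, rfl, _⟩ := h
  rfl

noncomputable def Fw (G : SimpleGraph (Fin K)) (P : Fin K → ℕ → ℝ) (p : Fin K → ℝ)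
    (w' : CState K) (x : Fin K → Bool) (i : Fin K) (b : ℕ) : ℝ :=
  if i ∈ Bbar G w' then 1 else (if x i then p i * fwt G P b i x else 1 - p i)

theorem Qtil_mk {G : SimpleGraph (Fin K)} {P : Fin K → ℕ → ℝ} {p : Fin K → ℝ} {γ bmax : ℕ}
    (hγ : 1 ≤ γ) (hP0 : ∀ k, P k 0 = 0)
    {w' : CState K} (hw' : ValidState G P γ w') {s : (_ : Fin K → Bool) × (Fin K → ℕ)}
    (hs : s ∈ Sall G P γ bmax w') :
    Qtil G P p γ w' (mkS G w' s) = ∏ i, Fw G P p w' s.1 i (s.2 i) := by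
  obtain ⟨hv, hA⟩ := mk_valid hγ hP0 hw' hs
  have hB := A1bar_eq hv hA
  rw [Qtil, if_pos (mk_adm hγ hP0 hw' hs), A2, hB]
  have : ∀ i, i ∉ Finset.univ \ Bbar G w' → Fw G P p w' s.1 i (s.2 i) = 1 := by
    intro i hi
    have : i ∈ Bbar G w' := by simpa using hi
    simp [Fw, this]
  rw [← Finset.prod_subset (Finset.subset_univ (Finset.univ \ Bbar G w')) (fun i _ hi => this i hi)]
  refine Finset.prod_congr rfl fun i hi => ?_
  have : i ∉ Bbar G w' := by simpa using hi
  simp only [Fw, this, mkS, if_false]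
  by_cases hx : s.1 i = true <;> simp [hx]

theorem sum_Fw {G : SimpleGraph (Fin K)} {P : Fin K → ℕ → ℝ} {p : Fin K → ℝ} {γ bmax : ℕ}
    (hPnn : ∀ k b, 0 ≤ P k b) (hPsum : ∀ k, ∑' b : ℕ, P k b = 1)
    (hb : ∀ k b, bmax < b → P k b = 0) (w' : CState K) (x : Fin K → Bool) (i : Fin K) :
    ∑ b ∈ tset G P γ bmax w' x i, Fw G P p w' x i b =
      if i ∈ Bbar G w' then 1 else (if x i then p i else 1 - p i) := by
  by_cases h : i ∈ Bbar G w'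
  · simp [tset, Fw, h]
  · cases hx : x i
    · simp [tset, Fw, h, hx]
    · by_cases hz : i ∈ Zset G x
      · simp [tset, Fw, h, hx, hz, fwt]
      · simp only [tset, Fw, h, hx, hz, fwt, if_true, if_false]
        rw [← Finset.mul_sum]
        have : ∑ b ∈ (Finset.range (bmax + 1)).filter (fun b => 0 < P i b), P i b = 1 := by
          rw [← hPsum i]
          symm
          apply tsum_eq_sum
          intro b hbn
          rw [Finset.mem_filter, Finset.mem_range] at hbn
          by_cases hlt : bmax < b
          · exact hb i b hlt
          · have : ¬ 0 < P i b := fun h => hbn ⟨by omega, h⟩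
            exact le_antisymm (not_lt.1 this) (hPnn i b)
        rw [this, mul_one]

/-- for every valid state `w'`, the time-reversed transition
probabilities sum to one: `Σ_{w valid} Q̃(w',w) = 1`. -/
theorem stmt4
    (K : ℕ) (hK : 1 ≤ K) (G : SimpleGraph (Fin K))
    (p : Fin K → ℝ) (hp : ∀ i, p i ∈ Set.Ioo (0 : ℝ) 1)
    (γ : ℕ) (hγ : 1 ≤ γ)
    (P : Fin K → ℕ → ℝ) (hP0 : ∀ k, P k 0 = 0) (hPnn : ∀ k b, 0 ≤ P k b)
    (hPsum : ∀ k, ∑' b : ℕ, P k b = 1)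
    (hPfin : ∃ bmax : ℕ, 0 < bmax ∧ ∀ k b, bmax < b → P k b = 0)
    (w' : CState K) (hw' : ValidState G P γ w') :
    (∑' w : {w : CState K // ValidState G P γ w}, Qtil G P p γ w' w.1) = 1 := by
  obtain ⟨bmax, _, hb⟩ := hPfin
  have e0 : (∑' w : {w : CState K // ValidState G P γ w}, Qtil G P p γ w' w.1) =
      ∑' w : CState K, Set.indicator {w | ValidState G P γ w} (Qtil G P p γ w') w :=
    tsum_subtype {w | ValidState G P γ w} (Qtil G P p γ w')
  rw [e0, tsum_eq_sum (s := (Sall G P γ bmax w').image (mkS G w')),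
    Finset.sum_image (fun _ _ _ _ h => mkS_inj G w' h)]
  · have e1 : ∀ s ∈ Sall G P γ bmax w',
        Set.indicator {w | ValidState G P γ w} (Qtil G P p γ w') (mkS G w' s) =
          ∏ i, Fw G P p w' s.1 i (s.2 i) := by
      intro s hs
      rw [Set.indicator_of_mem (show mkS G w' s ∈ {w | ValidState G P γ w} from
        (mk_valid hγ hP0 hw' hs).1), Qtil_mk hγ hP0 hw' hs]
    rw [Finset.sum_congr rfl e1, Sall, Finset.sum_sigma]
    simp only
    have e2 : ∀ x ∈ Xset G w', ∑ b ∈ Fintype.piFinset (tset G P γ bmax w' x),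
        ∏ i, Fw G P p w' x i (b i) =
          ∏ i, (if i ∈ Bbar G w' then (1 : ℝ) else (if x i then p i else 1 - p i)) := by
      intro x _
      rw [← Finset.prod_univ_sum]
      exact Finset.prod_congr rfl fun i _ => sum_Fw hPnn hPsum hb w' x i
    rw [Finset.sum_congr rfl e2, Xset,
      ← Finset.prod_univ_sum (fun i => if i ∈ Bbar G w' then {w'.x i} else Finset.univ)
        (fun i c => if i ∈ Bbar G w' then (1 : ℝ) else (if c then p i else 1 - p i))]
    apply Finset.prod_eq_one
    intro i _
    by_cases h : i ∈ Bbar G w' <;> simp [h]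
  · intro w hw
    by_cases hv : ValidState G P γ w
    · rw [Set.indicator_of_mem (show w ∈ {w | ValidState G P γ w} from hv), Qtil, if_neg]
      intro ha
      obtain ⟨s, hs, rfl⟩ := adm_mk hb hw' hv ha
      exact hw (Finset.mem_image_of_mem _ hs)
    · rw [Set.indicator_of_notMem (show w ∉ {w | ValidState G P γ w} from hv)]
end

section
/- For every ε ∈ (0,1), λ̄ᵀ·r*((1−ε)λ̄) ≤ [ log(N') + 2G* ]/ε. -/
open scoped BigOperators Classical

variable {K : ℕ}

/-- `g(x) = γ^{h(x)} ∏ᵢ pᵢ^{xᵢ} qᵢ^{1-xᵢ}`. -/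
noncomputable def gON (G : SimpleGraph (Fin K)) (p : Fin K → ℝ) (γ : ℕ)
    (x : Fin K → Bool) : ℝ :=
  (γ : ℝ) ^ hnum G x * ∏ i, (if x i then p i else 1 - p i)

/-- The normalizing constant `E(r)`. -/
noncomputable def Efun (G : SimpleGraph (Fin K)) (p : Fin K → ℝ) (γ : ℕ) (τ T₀ : ℝ)
    (r : Fin K → ℝ) : ℝ :=
  ∑ x : Fin K → Bool, gON G p γ x * ∏ k ∈ Sset G x, (τ + T₀ * Real.exp (r k))

/-- The stationary probability `p(x; r)` of the on-off state `x`. -/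
noncomputable def pON (G : SimpleGraph (Fin K)) (p : Fin K → ℝ) (γ : ℕ) (τ T₀ : ℝ)
    (x : Fin K → Bool) (r : Fin K → ℝ) : ℝ :=
  gON G p γ x * (∏ k ∈ Sset G x, (τ + T₀ * Real.exp (r k))) / Efun G p γ τ T₀ r

/-- The service rate `s_k(r)` of link `k`. -/
noncomputable def sRate (G : SimpleGraph (Fin K)) (p : Fin K → ℝ) (γ : ℕ) (τ T₀ : ℝ)
    (k : Fin K) (r : Fin K → ℝ) : ℝ :=
  T₀ * Real.exp (r k) / (τ + T₀ * Real.exp (r k)) *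
    ∑ x ∈ Finset.univ.filter (fun x : Fin K → Bool => k ∈ Sset G x), pON G p γ τ T₀ x r

/-- `L(r; λ) = Σ_k λ_k r_k − log E(r)`. -/
noncomputable def Lfun (G : SimpleGraph (Fin K)) (p : Fin K → ℝ) (γ : ℕ) (τ T₀ : ℝ)
    (r lam : Fin K → ℝ) : ℝ :=
  (∑ k, lam k * r k) - Real.log (Efun G p γ τ T₀ r)

/-- The indicator vectors of the independent sets of `G`. -/
def indVecs (G : SimpleGraph (Fin K)) : Set (Fin K → ℝ) :=
  {v | ∃ σ : Fin K → Bool, (∀ i j, σ i = true → σ j = true → ¬ G.Adj i j) ∧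
        v = fun i => if σ i then (1 : ℝ) else 0}

/-- `λ` is strictly feasible iff it lies in the interior of the convex hull of the
indicator vectors of the independent sets of `G`. -/
def strictlyFeasible (G : SimpleGraph (Fin K)) (lam : Fin K → ℝ) : Prop :=
  lam ∈ interior (convexHull ℝ (indVecs G))

/-- The finite set `𝒮` of detailed states `(x, z)`. -/
noncomputable def DS (G : SimpleGraph (Fin K)) : Finset ((Fin K → Bool) × (Fin K → Bool)) :=
  Finset.univ.filter (fun s => ∀ k, k ∉ Sset G s.1 → s.2 k = false)

/-- `g(x, z) = g(x) · (τ')^{|S(x)| − Σ_k z_k} · T₀^{Σ_k z_k}`. -/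
noncomputable def gDS (G : SimpleGraph (Fin K)) (p : Fin K → ℝ) (γ : ℕ) (τ T₀ : ℝ)
    (s : (Fin K → Bool) × (Fin K → Bool)) : ℝ :=
  gON G p γ s.1 *
    τ ^ ((Sset G s.1).card - (Finset.univ.filter (fun k => s.2 k = true)).card) *
    T₀ ^ (Finset.univ.filter (fun k => s.2 k = true)).card

/-- The stationary probability `p((x, z); r)` of the detailed state `(x, z)`. -/
noncomputable def pDS (G : SimpleGraph (Fin K)) (p : Fin K → ℝ) (γ : ℕ) (τ T₀ : ℝ)
    (s : (Fin K → Bool) × (Fin K → Bool)) (r : Fin K → ℝ) : ℝ :=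
  gDS G p γ τ T₀ s * Real.exp (∑ k, if s.2 k then r k else 0) / Efun G p γ τ T₀ r

lemma DS_nonempty (G : SimpleGraph (Fin K)) : (DS G).Nonempty :=
  ⟨⟨fun _ => false, fun _ => false⟩,
    Finset.mem_filter.mpr ⟨Finset.mem_univ _, fun _ _ => rfl⟩⟩

/-- `G* = max_{(x,z) ∈ 𝒮} |log g(x, z)|`. -/
noncomputable def Gstar (G : SimpleGraph (Fin K)) (p : Fin K → ℝ) (γ : ℕ) (τ T₀ : ℝ) : ℝ :=
  (DS G).sup' (DS_nonempty G) (fun s => |Real.log (gDS G p γ τ T₀ s)|)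

lemma aux_prod (S : Finset (Fin K)) (a b : Fin K → ℝ) :
    ∑ z : Fin K → Bool, (if (∀ k, k ∉ S → z k = false) then
      ∏ i ∈ S, (if z i then a i else b i) else 0) = ∏ i ∈ S, (b i + a i) := by
  have h := Finset.prod_univ_sum (fun i : Fin K => if i ∈ S then (Finset.univ : Finset Bool) else {false})
    (fun i c => if i ∈ S then (if c then a i else b i) else (1:ℝ))
  have h1 : ∀ i : Fin K, (∑ j ∈ (if i ∈ S then (Finset.univ : Finset Bool) else {false}),
      (if i ∈ S then (if j then a i else b i) else (1:ℝ))) = if i ∈ S then b i + a i else 1 := by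
    intro i
    by_cases hi : i ∈ S <;> simp [hi, add_comm]
  simp only [h1] at h
  rw [Finset.prod_ite_mem, Finset.univ_inter] at h
  rw [h, ← Finset.sum_filter]
  apply Finset.sum_congr
  · ext z
    simp only [Finset.mem_filter, Finset.mem_univ, true_and, Fintype.mem_piFinset]
    refine forall_congr' fun k => ?_
    by_cases hk : k ∈ S <;> simp [hk]
  · intro z _
    rw [Finset.prod_ite_mem, Finset.univ_inter]

lemma aux_term (G : SimpleGraph (Fin K)) (p : Fin K → ℝ) (γ : ℕ) (τ T₀ : ℝ) (r : Fin K → ℝ)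
    (x z : Fin K → Bool) (h : ∀ k, k ∉ Sset G x → z k = false) :
    gDS G p γ τ T₀ (x, z) * Real.exp (∑ k, if z k then r k else 0) =
      gON G p γ x * ∏ i ∈ Sset G x, (if z i then T₀ * Real.exp (r i) else τ) := by
  have e : (Finset.univ.filter (fun k => z k = true)) = (Sset G x).filter (fun k => z k = true) := by
    ext k
    simp only [Finset.mem_filter, Finset.mem_univ, true_and]
    refine ⟨fun hk => ⟨?_, hk⟩, fun hk => hk.2⟩
    by_contra hn
    simp [h k hn] at hk
  have e2 : (Sset G x).card - ((Sset G x).filter (fun k => z k = true)).card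
      = ((Sset G x).filter (fun k => ¬ z k = true)).card := by
    have := Finset.card_filter_add_card_filter_not (s := Sset G x) (fun k => z k = true)
    omega
  unfold gDS
  simp only
  rw [← Finset.sum_filter, Real.exp_sum, e, e2, Finset.prod_ite, Finset.prod_mul_distrib,
    Finset.prod_const, Finset.prod_const]
  ring

lemma gON_pos (G : SimpleGraph (Fin K)) (p : Fin K → ℝ) (hp : ∀ i, p i ∈ Set.Ioo (0 : ℝ) 1)
    (γ : ℕ) (hγ : 1 ≤ γ) (x : Fin K → Bool) : 0 < gON G p γ x := by
  unfold gON
  have : (0:ℝ) < γ := by exact_mod_cast hγ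
  refine mul_pos (by positivity) (Finset.prod_pos fun i _ => ?_)
  have := hp i
  split_ifs
  · exact this.1
  · linarith [this.2]

lemma gDS_pos (G : SimpleGraph (Fin K)) (p : Fin K → ℝ) (hp : ∀ i, p i ∈ Set.Ioo (0 : ℝ) 1)
    (γ : ℕ) (hγ : 1 ≤ γ) (τ T₀ : ℝ) (hτ : 0 < τ) (hT₀ : 0 < T₀) (s) : 0 < gDS G p γ τ T₀ s := by
  have := gON_pos G p hp γ hγ s.1
  unfold gDS
  positivity

lemma sum_DS (G : SimpleGraph (Fin K)) (F : (Fin K → Bool) → (Fin K → Bool) → ℝ) :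
    ∑ s ∈ DS G, F s.1 s.2 = ∑ x, ∑ z, if (∀ k, k ∉ Sset G x → z k = false) then F x z else 0 := by
  unfold DS
  rw [Finset.sum_filter, Fintype.sum_prod_type]

lemma Efun_eq (G : SimpleGraph (Fin K)) (p : Fin K → ℝ) (γ : ℕ) (τ T₀ : ℝ) (r : Fin K → ℝ) :
    Efun G p γ τ T₀ r =
      ∑ s ∈ DS G, gDS G p γ τ T₀ s * Real.exp (∑ k, if s.2 k then r k else 0) := by
  rw [sum_DS G (fun x z => gDS G p γ τ T₀ (x, z) * Real.exp (∑ k, if z k then r k else 0))]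
  unfold Efun
  refine Finset.sum_congr rfl fun x _ => ?_
  rw [← aux_prod, Finset.mul_sum]
  refine Finset.sum_congr rfl fun z _ => ?_
  split_ifs with h
  · rw [aux_term _ _ _ _ _ _ _ _ h]
  · simp

lemma sRate_eq (G : SimpleGraph (Fin K)) (p : Fin K → ℝ) (γ : ℕ) (τ T₀ : ℝ)
    (hτ : 0 < τ) (hT₀ : 0 < T₀) (r : Fin K → ℝ) (k : Fin K) :
    sRate G p γ τ T₀ k r = ∑ s ∈ DS G, pDS G p γ τ T₀ s r * (if s.2 k then 1 else 0) := by
  rw [sum_DS G (fun x z => pDS G p γ τ T₀ (x, z) r * (if z k then 1 else 0))]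
  unfold sRate
  rw [Finset.sum_filter, Finset.mul_sum]
  refine Finset.sum_congr rfl fun x _ => ?_
  have hterm : ∀ z : Fin K → Bool,
      (if (∀ j, j ∉ Sset G x → z j = false) then
        pDS G p γ τ T₀ (x, z) r * (if z k then 1 else 0) else 0) =
      if k ∈ Sset G x then gON G p γ x / Efun G p γ τ T₀ r *
        (if (∀ j, j ∉ Sset G x → z j = false) then
        ∏ i ∈ Sset G x, (if z i then T₀ * Real.exp (r i) else (if i = k then 0 else τ)) else 0)
      else 0 := by
    intro z
    by_cases h : ∀ j, j ∉ Sset G x → z j = false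
    · simp only [if_pos h]
      by_cases hk : k ∈ Sset G x
      · rw [if_pos hk]
        by_cases hz : z k = true
        · simp only [hz, if_true, mul_one]
          unfold pDS
          simp only
          rw [aux_term _ _ _ _ _ _ _ _ h, mul_div_right_comm]
          congr 1
          refine Finset.prod_congr rfl fun i _ => ?_
          by_cases hi : i = k
          · subst hi; simp [hz]
          · simp [hi]
        · rw [Finset.prod_eq_zero hk] <;> simp [hz]
      · simp [hk, h k hk]
    · simp only [if_neg h]; simp
  simp only [hterm]
  by_cases hk : k ∈ Sset G x
  · simp only [if_pos hk]
    rw [← Finset.mul_sum, aux_prod]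
    unfold pON
    rw [← Finset.mul_prod_erase _ _ hk, ← Finset.mul_prod_erase _ (fun i => (if i = k then 0 else τ) + _) hk]
    have : ∏ i ∈ (Sset G x).erase k, ((if i = k then 0 else τ) + T₀ * Real.exp (r i))
        = ∏ i ∈ (Sset G x).erase k, (τ + T₀ * Real.exp (r i)) :=
      Finset.prod_congr rfl fun i hi => by simp [Finset.ne_of_mem_erase hi]
    rw [this]
    have : 0 < τ + T₀ * Real.exp (r k) := by positivity
    simp only [if_true, zero_add]
    field_simp
  · simp [hk]

lemma hull_bound (G : SimpleGraph (Fin K)) (r lamb : Fin K → ℝ) (M : ℝ)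
    (hM : ∀ s ∈ DS G, (∑ k, if s.2 k then r k else 0) ≤ M)
    (hmem : lamb ∈ convexHull ℝ (indVecs G)) : ∑ k, lamb k * r k ≤ M := by
  have hc : Convex ℝ {v : Fin K → ℝ | ∑ k, v k * r k ≤ M} := by
    intro u hu v hv a b ha hb hab
    simp only [Set.mem_ofPred_eq] at *
    have : ∑ k, (a • u + b • v) k * r k = a * ∑ k, u k * r k + b * ∑ k, v k * r k := by
      rw [Finset.mul_sum, Finset.mul_sum, ← Finset.sum_add_distrib]
      refine Finset.sum_congr rfl fun k _ => ?_
      simp only [Pi.add_apply, Pi.smul_apply, smul_eq_mul]; ring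
    rw [this]
    calc _ ≤ a * M + b * M := by gcongr
      _ = M := by rw [← add_mul, hab, one_mul]
  refine convexHull_min ?_ hc hmem
  rintro v ⟨σ, hσ, rfl⟩
  have := hM (σ, σ) (by
    simp only [DS, Finset.mem_filter, Finset.mem_univ, true_and, Sset]
    intro k hk
    by_contra hn
    have hn' : σ k = true := by simpa using hn
    exact hk ⟨hn', fun j hj => hσ k j hn' hj⟩)
  simpa [ite_mul] using this

/-- for every `ε ∈ (0,1)`, `λ̄ᵀ·r*((1−ε)λ̄) ≤ [log(N') + 2G*]/ε`
(stated for any `r` with `s_k(r) = (1−ε)λ̄_k` for all `k`, i.e. for `r = r*((1−ε)λ̄)`). -/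
theorem stmt13
    (K : ℕ) (hK : 1 ≤ K) (G : SimpleGraph (Fin K))
    (p : Fin K → ℝ) (hp : ∀ i, p i ∈ Set.Ioo (0 : ℝ) 1)
    (γ : ℕ) (hγ : 1 ≤ γ) (τ T₀ : ℝ) (hτ : 0 < τ) (hT₀ : 0 < T₀)
    (lamb : Fin K → ℝ) (hpos : ∀ k, 0 < lamb k)
    (hmem : lamb ∈ convexHull ℝ (indVecs G))
    (hbdry : ∀ ρ : ℝ, 1 < ρ → ρ • lamb ∉ convexHull ℝ (indVecs G))
    : ∀ ε : ℝ, 0 < ε → ε < 1 →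
        ∀ r : Fin K → ℝ, (∀ k, sRate G p γ τ T₀ k r = (1 - ε) * lamb k) →
          (∑ k, lamb k * r k) ≤ (Real.log ((DS G).card) + 2 * Gstar G p γ τ T₀) / ε := by
  intro ε hε hε1 r hr
  rw [le_div_iff₀ hε]
  set Z := Efun G p γ τ T₀ r with hZ
  set q : (Fin K → Bool) × (Fin K → Bool) → ℝ := fun s => ∑ k, if s.2 k then r k else 0 with hq
  set g := gDS G p γ τ T₀ with hg
  set N : ℝ := ((DS G).card : ℝ) with hN
  have hgpos : ∀ s, 0 < g s := gDS_pos G p hp γ hγ τ T₀ hτ hT₀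
  have hZe : Z = ∑ s ∈ DS G, g s * Real.exp (q s) := Efun_eq G p γ τ T₀ r
  have hZpos : 0 < Z := by
    rw [hZe]
    exact Finset.sum_pos (fun s _ => mul_pos (hgpos s) (Real.exp_pos _)) (DS_nonempty G)
  have hNpos : 0 < N := by
    rw [hN]; exact_mod_cast Finset.card_pos.mpr (DS_nonempty G)
  have hGs : ∀ s ∈ DS G, |Real.log (g s)| ≤ Gstar G p γ τ T₀ := fun s hs =>
    Finset.le_sup' (fun s => |Real.log (gDS G p γ τ T₀ s)|) hs
  -- lower bound of the partition function
  have h1 : ∑ k, lamb k * r k ≤ Real.log Z + Gstar G p γ τ T₀ := by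
    refine hull_bound G r lamb _ (fun s hs => ?_) hmem
    have hle : g s * Real.exp (q s) ≤ Z := by
      rw [hZe]
      exact Finset.single_le_sum (f := fun s => g s * Real.exp (q s))
        (fun s _ => (mul_pos (hgpos s) (Real.exp_pos _)).le) hs
    have := Real.log_le_log (mul_pos (hgpos s) (Real.exp_pos _)) hle
    rw [Real.log_mul (hgpos s).ne' (Real.exp_pos _).ne', Real.log_exp] at this
    have h2 := neg_le_of_abs_le (hGs s hs)
    change q s ≤ _
    linarith
  -- the law
  set P : (Fin K → Bool) × (Fin K → Bool) → ℝ := fun s => pDS G p γ τ T₀ s r with hP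
  have hPe : ∀ s, P s = g s * Real.exp (q s) / Z := fun s => rfl
  have hPpos : ∀ s, 0 < P s := fun s => by
    rw [hPe]; exact div_pos (mul_pos (hgpos s) (Real.exp_pos _)) hZpos
  have hPsum : ∑ s ∈ DS G, P s = 1 := by
    simp only [hPe]
    rw [← Finset.sum_div, ← hZe, div_self hZpos.ne']
  have hmean : (1 - ε) * ∑ k, lamb k * r k = ∑ s ∈ DS G, P s * q s := by
    rw [Finset.mul_sum]
    have : ∀ k, (1 - ε) * (lamb k * r k) = ∑ s ∈ DS G, P s * (if s.2 k then r k else 0) := by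
      intro k
      rw [← mul_assoc, ← hr k, sRate_eq G p γ τ T₀ hτ hT₀, Finset.sum_mul]
      refine Finset.sum_congr rfl fun s _ => ?_
      rw [mul_assoc]; simp [hP]
    simp only [this]
    rw [Finset.sum_comm]
    refine Finset.sum_congr rfl fun s _ => ?_
    rw [← Finset.mul_sum]
  have hent : ∀ s ∈ DS G, P s * (Real.log Z - Gstar G p γ τ T₀ - Real.log N) + (P s - 1 / N)
      ≤ P s * q s := by
    intro s hs
    have hl : Real.log (P s) = Real.log (g s) + q s - Real.log Z := by
      rw [hPe, Real.log_div (mul_pos (hgpos s) (Real.exp_pos _)).ne' hZpos.ne',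
        Real.log_mul (hgpos s).ne' (Real.exp_pos _).ne', Real.log_exp]
    have ht := Real.log_le_sub_one_of_pos (x := 1 / (N * P s)) (by have := hPpos s; positivity)
    rw [one_div, Real.log_inv, Real.log_mul hNpos.ne' (hPpos s).ne'] at ht
    have h3 := mul_le_mul_of_nonneg_left ht (hPpos s).le
    have h4 : P s * ((N * P s)⁻¹ - 1) = 1 / N - P s := by
      have := (hPpos s).ne'
      field_simp
    rw [h4, hl] at h3
    have h5 := mul_le_mul_of_nonneg_left (le_of_abs_le (hGs s hs)) (hPpos s).le
    nlinarith
  have h6 := Finset.sum_le_sum hent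
  rw [← hmean, Finset.sum_add_distrib, ← Finset.sum_mul, hPsum, Finset.sum_sub_distrib, hPsum,
    Finset.sum_const, nsmul_eq_mul, ← hN, mul_one_div, div_self hNpos.ne'] at h6
  linarith
end
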